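/- For every integer d ≥ 2 there exists a constant C > 0, depending only on d, such that for every integer N ≥ 3 and every eigenvalue μ of the discrete torus T^d_N the following holds: if there is NO integer r with 1 ≤ r ≤ d and r ∈ I(0;N) such that either (r < d and μ is an eigenvalue of T^{d−r}_N) or (r = d and μ = 0), then the multiplicity satisfies m_{T^d_N}(μ) ≤ C. -/

import Mathlib

/-- The multiplicity of `μ` as an eigenvalue of the discrete torus `T^d_N`:
the number of tuples `(k_1, …, k_d) ∈ {0, …, N-1}^d` with
`∑_j 2 cos(2π k_j / N) = μ`. -/
noncomputable def torusMult (N d : ℕ) (μ : ℝ) : ℕ :=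
  Nat.card {k : Fin d → Fin N //
    (∑ j, 2 * Real.cos (2 * Real.pi * (k j : ℝ) / N)) = μ}

/-- The set `I(0;N)`: positive integers `r` such that `2r = ∑ b_l p_l` over the
distinct prime factors `p_l` of `N`, with at least one `b_l ≥ 2`. -/
def IZeroSet (N : ℕ) : Set ℕ :=
  {r | 0 < r ∧ ∃ b : ℕ → ℕ,
    2 * r = ∑ p ∈ N.primeFactors, b p * p ∧ ∃ p ∈ N.primeFactors, 2 ≤ b p}

open IntermediateField in
/-- Adjoining `ω` to the `m`-th cyclotomic field multiplies the degree by at least `φ(n) / φ(m)`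
as soon as the result contains a primitive `n`-th root of unity. -/
lemma totient_le_natDegree_minpoly_mul_totient {m n : ℕ} (hm : 0 < m) (hn : 0 < n) {ζ ω ξ : ℂ}
    (hζ : IsPrimitiveRoot ζ m) (hω : IsIntegral ℚ ω) (hξ : IsPrimitiveRoot ξ n)
    (hmem : ξ ∈ ℚ⟮ζ⟯⟮ω⟯) :
    n.totient ≤ (minpoly ℚ⟮ζ⟯ ω).natDegree * m.totient := by
  have key : ∀ {k : ℕ} {x : ℂ}, 0 < k → IsPrimitiveRoot x k →
      Module.finrank ℚ ℚ⟮x⟯ = k.totient := fun hk hx => by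
    rw [adjoin.finrank (hx.isIntegral hk).tower_top,
      ← Polynomial.cyclotomic_eq_minpoly_rat hx hk, Polynomial.natDegree_cyclotomic]
  have hω' : IsIntegral ℚ⟮ζ⟯ ω := hω.tower_top
  have : FiniteDimensional ℚ ℚ⟮ζ⟯ := adjoin.finiteDimensional (hζ.isIntegral hm).tower_top
  have : FiniteDimensional ℚ⟮ζ⟯ ℚ⟮ζ⟯⟮ω⟯ := adjoin.finiteDimensional hω'
  have : FiniteDimensional ℚ ℚ⟮ζ⟯⟮ω⟯ := FiniteDimensional.trans ℚ ℚ⟮ζ⟯ _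
  have : FiniteDimensional ℚ (ℚ⟮ζ⟯⟮ω⟯.restrictScalars ℚ) := this
  have hle : ℚ⟮ξ⟯ ≤ ℚ⟮ζ⟯⟮ω⟯.restrictScalars ℚ := by
    rw [adjoin_simple_le_iff]
    exact hmem
  calc n.totient = Module.finrank ℚ ℚ⟮ξ⟯ := (key hn hξ).symm
    _ ≤ Module.finrank ℚ (ℚ⟮ζ⟯⟮ω⟯.restrictScalars ℚ) := finrank_le_of_le_right hle
    _ = Module.finrank ℚ ℚ⟮ζ⟯⟮ω⟯ := rfl
    _ = Module.finrank ℚ ℚ⟮ζ⟯ * Module.finrank ℚ⟮ζ⟯ ℚ⟮ζ⟯⟮ω⟯ := (Module.finrank_mul_finrank _ _ _).symm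
    _ = _ := by rw [key hm hζ, adjoin.finrank hω', mul_comm]

/-- A polynomial expression in `x` of degree less than that of the minimal polynomial of `x`
over `K` vanishes only if its coefficients do. -/
lemma IntermediateField.coeff_eq_zero_of_sum_eq_zero {K : IntermediateField ℚ ℂ} {x : ℂ} {q : ℕ}
    (hq : q ≤ (minpoly K x).natDegree) {c : ℕ → ℂ} (hc : ∀ i, c i ∈ K)
    (h : ∑ i ∈ Finset.range q, c i * x ^ i = 0) : ∀ i < q, c i = 0 := by
  intro i hi
  have hli := (linearIndependent_pow (K := K) x)
  rw [Fintype.linearIndependent_iff] at hli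
  have := hli (fun j => if (j : ℕ) < q then ⟨c j, hc j⟩ else 0) (by
    rw [Fin.sum_univ_eq_sum_range
      (fun j => (if j < q then (⟨c j, hc j⟩ : K) else 0) • x ^ j) (minpoly K x).natDegree]
    rw [← h, ← Finset.sum_subset (Finset.range_subset_range.2 hq)]
    · refine Finset.sum_congr rfl fun j hj => ?_
      rw [if_pos (Finset.mem_range.1 hj)]
      rfl
    · intro j _ hj
      rw [if_neg (by simpa using hj), zero_smul]) ⟨i, hi.trans_le hq⟩
  simpa only [hi, if_true, Subtype.ext_iff, ZeroMemClass.coe_zero] using this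

open IntermediateField in
/-- For a prime `p`, there is an `ω` generating the `pm`-th roots of unity modulo the `m`-th ones
whose linear relations of length `p` over the `m`-th cyclotomic field are trivial if `p ∣ m`, and
multiples of `1 + ω + ⋯ + ω ^ (p - 1) = 0` otherwise. -/
lemma exists_root_of_unity_relations {m p : ℕ} (hm : 0 < m) (hp : p.Prime) {ζ : ℂ}
    (hζ : IsPrimitiveRoot ζ m) :
    ∃ ω : ℂ, IsPrimitiveRoot (ω ^ m) p ∧ ∀ c : ℕ → ℂ, (∀ i, c i ∈ ℚ⟮ζ⟯) →
      ∑ i ∈ Finset.range p, c i * ω ^ i = 0 →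
      (∀ i < p, ∀ j < p, c i = c j) ∧ (p ∣ m → ∀ i < p, c i = 0) := by
  have hφ : 0 < m.totient := Nat.totient_pos.2 hm
  by_cases hpm : p ∣ m
  · have hn : 0 < p * m := Nat.mul_pos hp.pos hm
    obtain ⟨ω, hω⟩ : ∃ ω : ℂ, IsPrimitiveRoot ω (p * m) :=
      ⟨_, Complex.isPrimitiveRoot_exp _ hn.ne'⟩
    have hdeg := totient_le_natDegree_minpoly_mul_totient hm hn hζ (hω.isIntegral hn).tower_top hω
      (mem_adjoin_simple_self _ _)
    rw [Nat.totient_mul_of_prime_of_dvd hp hpm] at hdeg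
    refine ⟨ω, hω.pow hn (mul_comm _ _), fun c hc h => ?_⟩
    have h0 := coeff_eq_zero_of_sum_eq_zero (Nat.le_of_mul_le_mul_right hdeg hφ) hc h
    exact ⟨fun i hi j hj => by rw [h0 i hi, h0 j hj], fun _ => h0⟩
  · have hcop : p.Coprime m := (Nat.Prime.coprime_iff_not_dvd hp).2 hpm
    obtain ⟨ω, hω⟩ : ∃ ω : ℂ, IsPrimitiveRoot ω p := ⟨_, Complex.isPrimitiveRoot_exp _ hp.ne_zero⟩
    have hprod : IsPrimitiveRoot (ω * ζ) (p * m) := by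
      rw [IsPrimitiveRoot.iff_orderOf,
        (Commute.all ω ζ).orderOf_mul_eq_mul_orderOf_of_coprime, ← hω.eq_orderOf, ← hζ.eq_orderOf]
      rwa [← hω.eq_orderOf, ← hζ.eq_orderOf]
    have hdeg := totient_le_natDegree_minpoly_mul_totient hm (Nat.mul_pos hp.pos hm) hζ
      (hω.isIntegral hp.pos).tower_top hprod
      (mul_mem (mem_adjoin_simple_self _ _)
        (IntermediateField.algebraMap_mem ℚ⟮ζ⟯⟮ω⟯ (⟨ζ, mem_adjoin_simple_self ℚ ζ⟩ : ℚ⟮ζ⟯)))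
    rw [Nat.totient_mul_of_prime_of_not_dvd hp hpm] at hdeg
    refine ⟨ω, hω.pow_of_coprime _ hcop.symm, fun c hc h => ?_⟩
    have h0 := coeff_eq_zero_of_sum_eq_zero (c := fun i => c i - c (p - 1))
      (Nat.le_of_mul_le_mul_right hdeg hφ) (fun i => sub_mem (hc i) (hc _)) (by
        have hg := hω.geom_sum_eq_zero hp.one_lt
        obtain ⟨q, rfl⟩ : ∃ q, p = q + 1 := ⟨p - 1, (Nat.sub_add_cancel hp.pos).symm⟩
        rw [Finset.sum_range_succ] at h hg
        simp only [sub_mul, Finset.sum_sub_distrib, ← Finset.mul_sum, Nat.add_sub_cancel]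
        linear_combination h - c q * hg)
    have h1 : ∀ i < p, c i = c (p - 1) := fun i hi => by
      rcases (Nat.le_sub_one_of_lt hi).lt_or_eq with h | h
      · exact sub_eq_zero.1 (h0 i h)
      · rw [h]
    exact ⟨fun i hi j hj => by rw [h1 i hi, h1 j hj], fun h => absurd h hpm⟩

/-- If `ω ^ m` is a primitive `p`-th root of unity, every `pm`-th root of unity is `ω ^ i` times
an `m`-th root of unity for some `i < p`. -/
lemma exists_eq_pow_mul_of_pow_eq_one {m p : ℕ} (hp : p.Prime) {ω z : ℂ}
    (hω : IsPrimitiveRoot (ω ^ m) p) (hz : z ^ (p * m) = 1) :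
    ∃ i < p, ∃ u : ℂ, u ^ m = 1 ∧ z = u * ω ^ i := by
  have : NeZero p := ⟨hp.ne_zero⟩
  obtain ⟨i, hi, h⟩ := hω.eq_pow_of_pow_eq_one (ξ := z ^ m) (by rw [← pow_mul, mul_comm, hz])
  have hω0 : ω ^ m ≠ 0 := hω.ne_zero hp.ne_zero
  by_cases hm : m = 0
  · subst hm
    exact absurd (hω.unique (by simp)) hp.one_lt.ne'
  have hω1 : ω ≠ 0 := fun h => hω0 (by rw [h, zero_pow hm])
  refine ⟨i, hi, z / ω ^ i, ?_, (div_mul_cancel₀ _ (pow_ne_zero _ hω1)).symm⟩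
  rw [div_pow, ← h, ← pow_mul, ← pow_mul, mul_comm, div_self (pow_ne_zero _ hω1)]

open IntermediateField in
lemma IsPrimitiveRoot.mem_adjoin_of_pow_eq_one {m : ℕ} (hm : 0 < m) {ζ u : ℂ}
    (hζ : IsPrimitiveRoot ζ m) (hu : u ^ m = 1) : u ∈ ℚ⟮ζ⟯ := by
  have : NeZero m := ⟨hm.ne'⟩
  obtain ⟨i, -, rfl⟩ := hζ.eq_pow_of_pow_eq_one hu
  exact pow_mem (mem_adjoin_simple_self _ _) i

/-- Sorting `pm`-th roots of unity into classes modulo the `m`-th ones. -/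
lemma exists_multiset_classes {m p : ℕ} (hp : p.Prime) {ω : ℂ} (hω : IsPrimitiveRoot (ω ^ m) p)
    (x : Multiset ℂ) (hx : ∀ z ∈ x, z ^ (p * m) = 1) :
    ∃ f : ℕ → Multiset ℂ, (∀ i, ∀ z ∈ f i, z ^ m = 1) ∧
      x.sum = ∑ i ∈ Finset.range p, (f i).sum * ω ^ i ∧
      x.card = ∑ i ∈ Finset.range p, (f i).card := by
  induction x using Multiset.induction with
  | empty => exact ⟨fun _ => 0, by simp⟩
  | cons z x ih =>
    obtain ⟨f, hf, hsum, hcard⟩ := ih fun w hw => hx w (Multiset.mem_cons_of_mem hw)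
    obtain ⟨i, hi, u, hu, rfl⟩ :=
      exists_eq_pow_mul_of_pow_eq_one hp hω (hx z (Multiset.mem_cons_self _ _))
    refine ⟨fun j => (if j = i then {u} else 0) + f j, fun j w hw => ?_, ?_, ?_⟩
    · rcases Multiset.mem_add.1 hw with hw | hw
      · split_ifs at hw
        · rwa [Multiset.mem_singleton.1 hw]
        · simp at hw
      · exact hf j w hw
    · simp [hsum, add_mul, Finset.sum_add_distrib, apply_ite Multiset.sum, ite_mul, hi]
    · simp [hcard, Finset.sum_add_distrib, apply_ite Multiset.card, hi, add_comm]

lemma card_eq_of_sum_eq_of_eq_one {x y : Multiset ℂ} (hx : ∀ z ∈ x, z ^ 1 = 1)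
    (hy : ∀ z ∈ y, z ^ 1 = 1) (h : x.sum = y.sum) : x.card = y.card := by
  rw [(Multiset.eq_replicate_card (s := x) (a := 1)).2 fun z hz => by simpa using hx z hz,
    (Multiset.eq_replicate_card (s := y) (a := 1)).2 fun z hz => by simpa using hy z hz] at h
  simpa using h

lemma exists_prime_mul_eq {a q n : ℕ} (hn : n ≠ 1) (hn0 : 0 < n)
    (h : ∀ p, p.Prime → p ∣ n → p = a ∨ q < p) :
    ∃ p m, p.Prime ∧ n = p * m ∧ (p ∣ m ∨ m = 1 ∨ q < p) := by
  by_cases hq : ∃ p, p.Prime ∧ p ∣ n ∧ q < p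
  · obtain ⟨p, hp, ⟨m, rfl⟩, hpq⟩ := hq
    exact ⟨p, m, hp, rfl, Or.inr (Or.inr hpq)⟩
  · have ha : ∀ p, p.Prime → p ∣ n → p = a := fun p hp hpn =>
      (h p hp hpn).resolve_right fun hlt => hq ⟨p, hp, hpn, hlt⟩
    obtain ⟨p, hp, hpn⟩ := Nat.exists_prime_and_dvd hn
    obtain ⟨m, rfl⟩ := hpn
    refine ⟨p, m, hp, rfl, ?_⟩
    by_cases hm : m = 1
    · exact Or.inr (Or.inl hm)
    · obtain ⟨r, hr, hrm⟩ := Nat.exists_prime_and_dvd hm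
      rw [ha p hp (dvd_mul_right _ _), ← ha r hr (hrm.mul_left _)]
      exact Or.inl hrm

/-- Let all prime factors of `n` be equal to `a` or greater than `q ≥ a`. If two multisets of
`n`-th roots of unity have the same sum, then their sizes differ by a nonnegative combination of
primes dividing `n`, or the first one is large. -/
theorem card_eq_add_or_le_card_of_sum_eq (W : AddSubmonoid ℕ) {a q : ℕ} (haq : a ≤ q) (n : ℕ)
    (hn : 0 < n) (hprime : ∀ p, p.Prime → p ∣ n → p ∈ W ∧ (p = a ∨ q < p)) (x y : Multiset ℂ)
    (hx : ∀ z ∈ x, z ^ n = 1) (hy : ∀ z ∈ y, z ^ n = 1) (hxy : x.sum = y.sum) :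
    (∃ w ∈ W, x.card = y.card + w) ∨ a * q ≤ x.card + y.card * q := by
  induction n using Nat.strong_induction_on generalizing x y with
  | _ n ih =>
  by_cases hn1 : n = 1
  · subst hn1
    exact Or.inl ⟨0, zero_mem _, card_eq_of_sum_eq_of_eq_one hx hy hxy⟩
  obtain ⟨p, m, hp, rfl, hpm⟩ := exists_prime_mul_eq hn1 hn fun p hp h => (hprime p hp h).2
  have hm : 0 < m := Nat.pos_of_mul_pos_left hn
  obtain ⟨hpW, hpa⟩ := hprime p hp (dvd_mul_right _ _)
  have ih' := ih m (by nlinarith [hp.two_le]) hm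
    fun r hr hrm => hprime r hr (hrm.mul_left _)
  by_cases hya : a ≤ y.card
  · exact Or.inr ((Nat.mul_le_mul_right _ hya).trans (Nat.le_add_left _ _))
  obtain ⟨ζ, hζ⟩ : ∃ ζ : ℂ, IsPrimitiveRoot ζ m := ⟨_, Complex.isPrimitiveRoot_exp _ hm.ne'⟩
  obtain ⟨ω, hω, hrel⟩ := exists_root_of_unity_relations hm hp hζ
  obtain ⟨f, hf, hfsum, hfcard⟩ := exists_multiset_classes hp hω x hx
  obtain ⟨g, hg, hgsum, hgcard⟩ := exists_multiset_classes hp hω y hy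
  have hcon := hrel (fun i => (f i).sum - (g i).sum)
    (fun i => sub_mem (multiset_sum_mem _ fun z hz => hζ.mem_adjoin_of_pow_eq_one hm (hf i z hz))
      (multiset_sum_mem _ fun z hz => hζ.mem_adjoin_of_pow_eq_one hm (hg i z hz)))
    (by simp only [sub_mul, Finset.sum_sub_distrib]; rw [← hfsum, ← hgsum, hxy, sub_self])
  by_cases hdvd : p ∣ m
  · have heq : ∀ i < p, (f i).sum = (g i).sum := fun i hi => sub_eq_zero.1 (hcon.2 hdvd i hi)
    by_cases hall : ∀ i ∈ Finset.range p, ∃ w ∈ W, (f i).card = (g i).card + w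
    · choose! w hw hfw using hall
      refine Or.inl ⟨∑ i ∈ Finset.range p, w i, sum_mem hw, ?_⟩
      rw [hfcard, hgcard, ← Finset.sum_add_distrib, Finset.sum_congr rfl hfw]
    · push Not at hall
      obtain ⟨i, hi, hne⟩ := hall
      have hle := (ih' (f i) (g i) (hf i) (hg i) (heq i (Finset.mem_range.1 hi))).resolve_left
        fun ⟨w, hw, h⟩ => hne w hw h
      refine Or.inr (hle.trans ?_)
      rw [hfcard, hgcard]
      gcongr
      · exact Finset.single_le_sum (f := fun i => (f i).card) (fun _ _ => Nat.zero_le _) hi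
      · exact Finset.single_le_sum (f := fun i => (g i).card) (fun _ _ => Nat.zero_le _) hi
  · have hZ : ((Finset.range p).filter fun i => g i = 0).Nonempty := by
      by_contra hemp
      rw [Finset.not_nonempty_iff_eq_empty, Finset.filter_eq_empty_iff] at hemp
      have : ∑ i ∈ Finset.range p, 1 ≤ ∑ i ∈ Finset.range p, (g i).card :=
        Finset.sum_le_sum fun i hi => Multiset.card_pos.2 (hemp hi)
      rw [← hgcard, Finset.sum_const, Finset.card_range, smul_eq_mul, mul_one] at this
      omega
    obtain ⟨k, hk, hmin⟩ := Finset.exists_min_image _ (fun i => (f i).card) hZ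
    rw [Finset.mem_filter, Finset.mem_range] at hk
    have heq : ∀ i < p, (f i).sum = (g i + f k).sum := fun i hi => by
      have := hcon.1 i hi k hk.1
      simp only [hk.2, Multiset.sum_zero, sub_zero] at this
      rw [Multiset.sum_add, ← this, add_sub_cancel]
    have hgf : ∀ i, ∀ z ∈ g i + f k, z ^ m = 1 := fun i z hz =>
      (Multiset.mem_add.1 hz).elim (hg i z) (hf k z)
    by_cases hall : ∀ i ∈ Finset.range p, ∃ w ∈ W, (f i).card = (g i + f k).card + w
    · choose! w hw hfw using hall
      refine Or.inl ⟨(f k).card • p + ∑ i ∈ Finset.range p, w i,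
        add_mem (nsmul_mem hpW _) (sum_mem hw), ?_⟩
      rw [hfcard, hgcard, Finset.sum_congr rfl hfw, Finset.sum_add_distrib]
      simp only [Multiset.card_add, Finset.sum_add_distrib, Finset.sum_const, Finset.card_range,
        smul_eq_mul]
      ring
    · push Not at hall
      obtain ⟨i, hi, hne⟩ := hall
      have hqp : q < p := by
        refine (hpm.resolve_left hdvd).resolve_left fun h => ?_
        subst h
        exact hne 0 (zero_mem _)
          (card_eq_of_sum_eq_of_eq_one (hf i) (hgf i) (heq i (Finset.mem_range.1 hi)))
      have hle := (ih' (f i) _ (hf i) (hgf i) (heq i (Finset.mem_range.1 hi))).resolve_left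
        fun ⟨w, hw, h⟩ => hne w hw h
      rw [Multiset.card_add] at hle
      rw [← Finset.add_sum_erase _ _ hi] at hfcard hgcard
      set s := (Finset.range p).erase i with hs
      have hcard : s.card = p - 1 := by rw [hs, Finset.card_erase_of_mem hi, Finset.card_range]
      set c := ∑ j ∈ s, if g j = 0 then 1 else 0 with hc
      have hc1 : q ≤ c + ∑ j ∈ s, (g j).card := by
        have : ∑ j ∈ s, 1 ≤ ∑ j ∈ s, ((if g j = 0 then 1 else 0) + (g j).card) :=
          Finset.sum_le_sum fun j _ => by
            split_ifs with h
            · simp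
            · rw [zero_add]
              exact Multiset.card_pos.2 h
        rw [Finset.sum_add_distrib, Finset.sum_const, hcard, smul_eq_mul, mul_one] at this
        omega
      have hc2 : (f k).card * c ≤ ∑ j ∈ s, (f j).card := by
        rw [hc, Finset.mul_sum]
        refine Finset.sum_le_sum fun j hj => ?_
        split_ifs with h
        · simpa using hmin j (Finset.mem_filter.2 ⟨Finset.mem_of_mem_erase hj, h⟩)
        · simp
      right
      rw [hfcard, hgcard]
      generalize (f i).card = X at *
      generalize (g i).card = e at *
      generalize (f k).card = t at *
      generalize ∑ j ∈ s, (f j).card = Y at *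
      generalize ∑ j ∈ s, (g j).card = r at *
      by_cases hta : a ≤ e + t
      · nlinarith
      · nlinarith

/-- **Lam–Leung theorem**: the number of terms in a vanishing sum of `N`-th roots of unity is a
nonnegative integer combination of the prime factors of `N`. -/
theorem card_mem_closure_primeFactors_of_sum_eq_zero {N : ℕ} (hN : 0 < N) (x : Multiset ℂ)
    (hx : ∀ z ∈ x, z ^ N = 1) (hsum : x.sum = 0) :
    x.card ∈ AddSubmonoid.closure (N.primeFactors : Set ℕ) := by
  set W := AddSubmonoid.closure (N.primeFactors : Set ℕ)
  have hW : ∀ p, p.Prime → p ∣ N → p ∈ W := fun p hp h =>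
    AddSubmonoid.subset_closure (by simpa [hN.ne'] using ⟨hp, h⟩)
  by_cases hN1 : N = 1
  · subst hN1
    rw [card_eq_of_sum_eq_of_eq_one (y := 0) hx (by simp) (by simpa using hsum)]
    exact zero_mem _
  have hcomplete : ∀ a q, a ≤ q → (∀ p, p.Prime → p ∣ N → p = a ∨ q < p) →
      x.card ∈ W ∨ a * q ≤ x.card := fun a q haq h => by
    rcases card_eq_add_or_le_card_of_sum_eq W haq N hN (fun p hp hpN => ⟨hW p hp hpN, h p hp hpN⟩)
      x 0 hx (by simp) (by simpa using hsum) with ⟨w, hw, hxw⟩ | h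
    · left
      simpa [hxw] using hw
    · right
      simpa using h
  set a := N.minFac
  have ha : a.Prime := Nat.minFac_prime hN1
  by_cases hex : ∃ p, p.Prime ∧ p ∣ N ∧ p ≠ a
  · classical
    have hspec := Nat.find_spec hex
    have hfind := fun m => Nat.find_min' hex (m := m)
    set b := Nat.find hex
    have hab : a < b := lt_of_le_of_ne (Nat.minFac_le_of_dvd hspec.1.two_le hspec.2.1) hspec.2.2.symm
    rcases hcomplete a (b - 1) (Nat.le_sub_one_of_lt hab) (fun p hp hpN => by
      by_cases hpa : p = a
      · exact Or.inl hpa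
      · have := hfind p ⟨hp, hpN, hpa⟩
        have := hspec.1.pos
        omega) with h | h
    · exact h
    · by_contra hmem
      have hcop : a.Coprime b := (Nat.coprime_primes ha hspec.1).2 hab.ne
      have hfrob := frobeniusNumber_pair hcop ha.one_lt hspec.1.one_lt
      have : x.card ≤ a * b - a - b := hfrob.2 fun hmem' => hmem
        (AddSubmonoid.closure_le.2 (by
          rintro z (rfl | rfl)
          · exact hW _ ha (Nat.minFac_dvd N)
          · exact hW _ hspec.1 hspec.2.1) hmem')
      rw [Nat.mul_sub, mul_one] at h
      have : a + b ≤ a * b := Nat.add_le_mul ha.two_le hspec.1.two_le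
      have := hspec.1.pos
      omega
  · push Not at hex
    rcases hcomplete a (a + x.card) (Nat.le_add_right _ _)
      (fun p hp hpN => Or.inl (hex p hp hpN)) with h | h
    · exact h
    · nlinarith [ha.two_le]

/-- If the ratios of the terms of a minimal vanishing sum are `pm`-th roots of unity, where `p` is a
prime that divides `m` or exceeds the number of terms, then they are `m`-th roots of unity. -/
lemma div_pow_eq_one_of_minimal_vanishing {ι : Type*} {S : Finset ι} {z : ι → ℂ}
    (hz0 : ∀ i ∈ S, z i ≠ 0) (hsum : ∑ i ∈ S, z i = 0)
    (hmin : ∀ T ⊆ S, T.Nonempty → ∑ i ∈ T, z i = 0 → T = S) {m p : ℕ} (hm : 0 < m)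
    (hp : p.Prime) (hpm : p ∣ m ∨ S.card < p)
    (hz : ∀ i ∈ S, ∀ j ∈ S, (z i / z j) ^ (p * m) = 1) :
    ∀ i ∈ S, ∀ j ∈ S, (z i / z j) ^ m = 1 := by
  classical
  intro i₁ hi₁ i₀ hi₀
  obtain ⟨ζ, hζ⟩ : ∃ ζ : ℂ, IsPrimitiveRoot ζ m := ⟨_, Complex.isPrimitiveRoot_exp _ hm.ne'⟩
  obtain ⟨ω, hω, hrel⟩ := exists_root_of_unity_relations hm hp hζ
  have hω0 : ω ≠ 0 := fun h => hω.ne_zero hp.ne_zero (by rw [h, zero_pow hm.ne'])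
  have hdecomp : ∀ i ∈ S, ∃ e < p, ∃ u : ℂ, u ^ m = 1 ∧ z i / z i₀ = u * ω ^ e :=
    fun i hi => exists_eq_pow_mul_of_pow_eq_one hp hω (hz i hi i₀ hi₀)
  choose! e he u hu hzu using hdecomp
  set c : ℕ → ℂ := fun k => ∑ i ∈ S with e i = k, u i with hc
  have hcmem : ∀ k, c k ∈ IntermediateField.adjoin ℚ {ζ} := fun k => sum_mem fun i hi =>
    hζ.mem_adjoin_of_pow_eq_one hm (hu i (Finset.mem_filter.1 hi).1)
  have hclass : ∀ k, c k * ω ^ k = (∑ i ∈ S with e i = k, z i) / z i₀ := fun k => by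
    rw [hc, Finset.sum_mul, Finset.sum_div]
    refine Finset.sum_congr rfl fun i hi => ?_
    rw [Finset.mem_filter] at hi
    rw [hzu i hi.1, hi.2]
  have hczero : ∑ k ∈ Finset.range p, c k * ω ^ k = 0 := by
    simp only [hclass, ← Finset.sum_div]
    rw [Finset.sum_fiberwise_of_maps_to fun i hi => Finset.mem_range.2 (he i hi), hsum, zero_div]
  obtain ⟨heq, hdvd⟩ := hrel c hcmem hczero
  have hc0 : c (e i₀) = 0 := by
    rcases hpm with h | h
    · exact hdvd h _ (he i₀ hi₀)
    · obtain ⟨k, hk, hkS⟩ : ∃ k ∈ Finset.range p, k ∉ S.image e :=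
        Finset.exists_mem_notMem_of_card_lt_card
          (Finset.card_image_le.trans_lt (by rwa [Finset.card_range]))
      rw [heq _ (he i₀ hi₀) k (Finset.mem_range.1 hk)]
      refine Finset.sum_eq_zero fun i hi => ?_
      rw [Finset.mem_filter] at hi
      exact absurd (Finset.mem_image.2 ⟨i, hi⟩) hkS
  have hT : (S.filter fun i => e i = e i₀) = S := by
    refine hmin _ (Finset.filter_subset _ _) ⟨i₀, Finset.mem_filter.2 ⟨hi₀, rfl⟩⟩ ?_
    have := hclass (e i₀)
    rw [hc0, zero_mul, eq_comm, div_eq_zero_iff] at this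
    exact this.resolve_right (hz0 i₀ hi₀)
  have he₁ : e i₁ = e i₀ := Finset.filter_eq_self.1 hT i₁ hi₁
  have h₀ := hzu i₀ hi₀
  rw [div_self (hz0 i₀ hi₀)] at h₀
  have h₁ : z i₁ / z i₀ = u i₁ / u i₀ := by
    have hu0 : u i₀ ≠ 0 := fun h => by simp [h] at h₀
    rw [hzu i₁ hi₁, he₁, eq_div_iff hu0]
    linear_combination -u i₁ * h₀
  rw [h₁, div_pow, hu i₁ hi₁, hu i₀ hi₀, div_one]

lemma Nat.dvd_factorial_or_exists_prime {n : ℕ} (hn : 0 < n) (k : ℕ) :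
    n ∣ k.factorial ∨ ∃ p m, p.Prime ∧ n = p * m ∧ (p ∣ m ∨ k < p) := by
  by_cases hsq : Squarefree n
  · by_cases hk : ∀ p, p.Prime → p ∣ n → p ≤ k
    · left
      rw [← Nat.prod_primeFactors_of_squarefree hsq]
      refine Finset.prod_primes_dvd _ (fun p hp => (Nat.prime_of_mem_primeFactors hp).prime)
        fun p hp => ?_
      have hp' := Nat.prime_of_mem_primeFactors hp
      exact Nat.dvd_factorial hp'.pos (hk p hp' (Nat.dvd_of_mem_primeFactors hp))
    · push Not at hk
      obtain ⟨p, hp, ⟨m, rfl⟩, hkp⟩ := hk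
      exact Or.inr ⟨p, m, hp, rfl, Or.inr hkp⟩
  · rw [Nat.squarefree_iff_prime_squarefree] at hsq
    push Not at hsq
    obtain ⟨p, hp, m, rfl⟩ := hsq
    exact Or.inr ⟨p, p * m, hp, mul_assoc _ _ _, Or.inl (dvd_mul_right _ _)⟩

/-- **Mann's theorem**: the order of the ratio of two terms in a minimal vanishing sum of `k` roots
of unity divides `k!`. -/
theorem div_pow_factorial_eq_one_of_minimal_vanishing {ι : Type*} {S : Finset ι} {z : ι → ℂ}
    (hz0 : ∀ i ∈ S, z i ≠ 0) (hsum : ∑ i ∈ S, z i = 0)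
    (hmin : ∀ T ⊆ S, T.Nonempty → ∑ i ∈ T, z i = 0 → T = S) {n : ℕ} (hn : 0 < n)
    (hz : ∀ i ∈ S, ∀ j ∈ S, (z i / z j) ^ n = 1) :
    ∀ i ∈ S, ∀ j ∈ S, (z i / z j) ^ S.card.factorial = 1 := by
  induction n using Nat.strong_induction_on with
  | _ n ih =>
  rcases Nat.dvd_factorial_or_exists_prime hn S.card with ⟨r, hr⟩ | ⟨p, m, hp, rfl, hpm⟩
  · intro i hi j hj
    rw [hr, pow_mul, hz i hi j hj, one_pow]
  · have hm : 0 < m := Nat.pos_of_mul_pos_left hn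
    exact ih m (by nlinarith [hp.two_le]) hm
      (div_pow_eq_one_of_minimal_vanishing hz0 hsum hmin hm hp hpm hz)

lemma exists_minimal_vanishing_of_mem {ι : Type*} {U : Finset ι} {z : ι → ℂ}
    (hsum : ∑ i ∈ U, z i = 0) {i : ι} (hi : i ∈ U) :
    ∃ S ⊆ U, i ∈ S ∧ ∑ j ∈ S, z j = 0 ∧
      ∀ T ⊆ S, T.Nonempty → ∑ j ∈ T, z j = 0 → T = S := by
  classical
  obtain ⟨S, hS, hmin⟩ := Finset.exists_min_image
    (U.powerset.filter fun S => i ∈ S ∧ ∑ j ∈ S, z j = 0) Finset.card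
    ⟨U, by simp [hi, hsum]⟩
  simp only [Finset.mem_filter, Finset.mem_powerset] at hS hmin
  obtain ⟨hSU, hiS, hS0⟩ := hS
  refine ⟨S, hSU, hiS, hS0, fun T hT hne hT0 => ?_⟩
  by_cases hiT : i ∈ T
  · exact Finset.eq_of_subset_of_card_le hT (hmin T ⟨hT.trans hSU, hiT, hT0⟩)
  · have h0 : ∑ j ∈ S \ T, z j = 0 := by
      have := Finset.sum_sdiff (f := z) hT
      rwa [hT0, hS0, add_zero] at this
    have hle := hmin (S \ T)
      ⟨Finset.sdiff_subset.trans hSU, Finset.mem_sdiff.2 ⟨hiS, hiT⟩, h0⟩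
    rw [Finset.card_sdiff_of_subset hT] at hle
    have := hne.card_pos
    have := Finset.card_le_card hT
    omega

lemma card_mem_IZeroSet_of_sum_eq_zero {N : ℕ} (hN : 0 < N) {x : Multiset ℂ} (hx0 : x ≠ 0)
    (hx : ∀ z ∈ x, z ^ N = 1) (hsum : x.sum = 0) : x.card ∈ IZeroSet N := by
  have hpos := Multiset.card_pos.2 hx0
  obtain ⟨f, -, hf⟩ := AddSubmonoid.mem_closure_finset.1
    (card_mem_closure_primeFactors_of_sum_eq_zero hN x hx hsum)
  simp only [smul_eq_mul] at hf
  refine ⟨hpos, fun p => 2 * f p, ?_, ?_⟩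
  · simp only [← hf, Finset.mul_sum, mul_assoc]
  · by_contra! hlt
    have : ∑ p ∈ N.primeFactors, f p * p = 0 := Finset.sum_eq_zero fun p hp => by
      have : f p = 0 := by have := hlt p hp; omega
      simp [this]
    omega

/-- The roots of unity `exp (± 2πi k_j / N)` attached to a point `k` of the discrete torus. -/
noncomputable def torusRoot {N d : ℕ} (k : Fin d → Fin N) (s : Fin d × Bool) : ℂ :=
  if s.2 then Complex.exp (2 * Real.pi * Complex.I / N) ^ (k s.1 : ℕ)
  else (Complex.exp (2 * Real.pi * Complex.I / N) ^ (k s.1 : ℕ))⁻¹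

section torusRoot

variable {N d : ℕ} (k : Fin d → Fin N)

lemma torusRoot_pow (hN : N ≠ 0) (s : Fin d × Bool) : torusRoot k s ^ N = 1 := by
  have h := (Complex.isPrimitiveRoot_exp N hN).pow_eq_one
  unfold torusRoot
  split_ifs
  · rw [pow_right_comm, h, one_pow]
  · rw [inv_pow, pow_right_comm, h, one_pow, inv_one]

lemma torusRoot_ne_zero (s : Fin d × Bool) : torusRoot k s ≠ 0 := by
  unfold torusRoot
  split_ifs
  · exact pow_ne_zero _ (Complex.exp_ne_zero _)
  · exact inv_ne_zero (pow_ne_zero _ (Complex.exp_ne_zero _))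

lemma torusRoot_not (j : Fin d) (b : Bool) : torusRoot k (j, !b) = (torusRoot k (j, b))⁻¹ := by
  cases b <;> simp [torusRoot]

lemma two_mul_re_torusRoot (s : Fin d × Bool) :
    2 * (torusRoot k s).re = 2 * Real.cos (2 * Real.pi * (k s.1 : ℝ) / N) := by
  have h : Complex.exp (2 * Real.pi * Complex.I / N) ^ (k s.1 : ℕ) =
      Complex.exp ((2 * Real.pi * (k s.1 : ℝ) / N : ℝ) * Complex.I) := by
    rw [← Complex.exp_nat_mul]
    congr 1
    push_cast
    ring
  unfold torusRoot
  rw [h]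
  split_ifs
  · rw [Complex.exp_ofReal_mul_I_re]
  · rw [← Complex.exp_neg, ← neg_mul, ← Complex.ofReal_neg, Complex.exp_ofReal_mul_I_re,
      Real.cos_neg]

lemma sum_torusRoot :
    ∑ s, torusRoot k s = ((∑ j, 2 * Real.cos (2 * Real.pi * (k j : ℝ) / N) : ℝ) : ℂ) := by
  rw [Fintype.sum_prod_type, Complex.ofReal_sum]
  refine Finset.sum_congr rfl fun j _ => ?_
  have hnorm : ‖torusRoot k (j, true)‖ = 1 := by
    rcases eq_or_ne N 0 with rfl | hN
    · exact (k j).elim0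
    · exact Complex.norm_eq_one_of_pow_eq_one (torusRoot_pow k hN _) hN
  have hconj : torusRoot k (j, false) = (starRingEnd ℂ) (torusRoot k (j, true)) := by
    rw [← Complex.inv_eq_conj hnorm, ← torusRoot_not, Bool.not_true]
  rw [Fintype.sum_bool, hconj, Complex.add_conj, ← two_mul_re_torusRoot k (j, true)]

/-- A vanishing subsum of the torus roots that does not contain a root together with its inverse
can be removed, together with its complex conjugate, leaving a point of a lower-dimensional
torus. -/
lemma exists_lower_dim_eigenvalue (hN : N ≠ 0) {μ : ℝ}
    (hk : ∑ j, 2 * Real.cos (2 * Real.pi * (k j : ℝ) / N) = μ) {S : Finset (Fin d × Bool)}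
    (hS : S.Nonempty) (hsum : ∑ s ∈ S, torusRoot k s = 0)
    (hdisj : ∀ j b, (j, b) ∈ S → (j, !b) ∉ S) :
    ∃ r : ℕ, 1 ≤ r ∧ r ≤ d ∧ r ∈ IZeroSet N ∧
      ((r < d ∧ 1 ≤ torusMult N (d - r) μ) ∨ (r = d ∧ μ = 0)) := by
  have hinj : Set.InjOn Prod.fst (S : Set (Fin d × Bool)) := by
    rintro ⟨j, b⟩ hs ⟨j', b'⟩ hs' (rfl : j = j')
    have := hdisj j b hs
    cases b <;> cases b' <;> first | rfl | exact absurd hs' this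
  set J := S.image Prod.fst with hJ
  have hcard : J.card = S.card := Finset.card_image_of_injOn hinj
  have hJ0 : ∑ j ∈ J, 2 * Real.cos (2 * Real.pi * (k j : ℝ) / N) = 0 := by
    rw [hJ, Finset.sum_image hinj]
    simp only [← two_mul_re_torusRoot, ← Finset.mul_sum, ← Complex.re_sum, hsum]
    simp
  have hI : J.card ∈ IZeroSet N := by
    have := card_mem_IZeroSet_of_sum_eq_zero (Nat.pos_of_ne_zero hN)
      (x := S.val.map (torusRoot k)) (by simpa using hS.ne_empty)
      (fun z hz => by
        obtain ⟨s, -, rfl⟩ := Multiset.mem_map.1 hz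
        exact torusRoot_pow k hN s) hsum
    rwa [Multiset.card_map, Finset.card_val, ← hcard] at this
  have hJd : J.card ≤ d := by simpa using Finset.card_le_univ J
  refine ⟨J.card, hI.1, hJd, hI, ?_⟩
  have hcompl : ∑ j ∈ Jᶜ, 2 * Real.cos (2 * Real.pi * (k j : ℝ) / N) = μ := by
    rw [← hk, ← Finset.sum_add_sum_compl J, hJ0, zero_add]
  rcases hJd.lt_or_eq with hlt | heq
  · refine Or.inl ⟨hlt, Nat.card_pos_iff.2 ⟨⟨?_⟩, inferInstance⟩⟩
    have e := Jᶜ.equivFinOfCardEq (by rw [Finset.card_compl, Fintype.card_fin])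
    refine ⟨fun i => k (e.symm i), ?_⟩
    rw [← hcompl, ← Finset.sum_coe_sort Jᶜ]
    exact e.symm.sum_comp fun j => 2 * Real.cos (2 * Real.pi * (k j : ℝ) / N)
  · refine Or.inr ⟨heq, ?_⟩
    rw [← hcompl, (Finset.card_eq_iff_eq_univ J).1 (by simpa using heq)]
    simp

/-- Unless the eigenvalue comes from a lower-dimensional torus, each root of a point `k` either has
bounded order or differs from a root of `l` by a root of unity of bounded order. -/
lemma torusRoot_pow_eq_one_or_exists (l : Fin d → Fin N) (hN : N ≠ 0) {μ : ℝ}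
    (hk : ∑ j, 2 * Real.cos (2 * Real.pi * (k j : ℝ) / N) = μ)
    (hl : ∑ j, 2 * Real.cos (2 * Real.pi * (l j : ℝ) / N) = μ)
    (hno : ¬ ∃ r : ℕ, 1 ≤ r ∧ r ≤ d ∧ r ∈ IZeroSet N ∧
      ((r < d ∧ 1 ≤ torusMult N (d - r) μ) ∨ (r = d ∧ μ = 0))) (s : Fin d × Bool) :
    torusRoot k s ^ (2 * (4 * d).factorial) = 1 ∨
      ∃ t, (torusRoot k s / -torusRoot l t) ^ (4 * d).factorial = 1 := by
  set z : (Fin d × Bool) ⊕ (Fin d × Bool) → ℂ :=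
    Sum.elim (torusRoot k) (fun t => -torusRoot l t) with hz
  have hz0 : ∀ i, z i ≠ 0 := by
    rintro (s | t)
    · exact torusRoot_ne_zero k s
    · exact neg_ne_zero.2 (torusRoot_ne_zero l t)
  have hzN : ∀ i, z i ^ (2 * N) = 1 := by
    rintro (s | t)
    · rw [hz, Sum.elim_inl, mul_comm, pow_mul, torusRoot_pow k hN, one_pow]
    · rw [hz, Sum.elim_inr, pow_mul, neg_sq, ← pow_mul, mul_comm, pow_mul, torusRoot_pow l hN,
        one_pow]
  have hsum : ∑ i, z i = 0 := by
    rw [Fintype.sum_sum_type]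
    simp only [hz, Sum.elim_inl, Sum.elim_inr, Finset.sum_neg_distrib, sum_torusRoot, hk, hl,
      add_neg_cancel]
  obtain ⟨S, -, hsS, hS0, hmin⟩ := exists_minimal_vanishing_of_mem hsum (Finset.mem_univ (Sum.inl s))
  have hcard : S.card ≤ 4 * d := by
    refine (Finset.card_le_univ S).trans_eq ?_
    simp only [Fintype.card_sum, Fintype.card_prod, Fintype.card_fin, Fintype.card_bool]
    ring
  have hratio : ∀ i ∈ S, ∀ j ∈ S, (z i / z j) ^ (4 * d).factorial = 1 := fun i hi j hj => by
    obtain ⟨r, hr⟩ := Nat.factorial_dvd_factorial hcard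
    rw [hr, pow_mul, div_pow_factorial_eq_one_of_minimal_vanishing (n := 2 * N)
      (fun i _ => hz0 i) hS0 hmin (by omega)
      (fun i _ j _ => by rw [div_pow, hzN, hzN, div_one]) i hi j hj, one_pow]
  by_contra! hcon
  obtain ⟨horder, hright⟩ := hcon
  have hS : S = S.toLeft.disjSum ∅ := by
    rw [← S.toLeft_disjSum_toRight]
    simp only [Finset.toLeft_disjSum]
    congr 1
    refine Finset.eq_empty_of_forall_notMem fun t ht => ?_
    exact hright t (hratio _ hsS _ (Finset.mem_toRight.1 ht))
  refine hno (exists_lower_dim_eigenvalue k hN hk (S := S.toLeft)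
    ⟨s, Finset.mem_toLeft.2 hsS⟩ ?_ fun j b hb hnb => horder ?_)
  · rw [hS, Finset.sum_disjSum] at hS0
    simpa only [hz, Sum.elim_inl, Finset.sum_empty, add_zero] using hS0
  · have h₁ := hratio _ hsS _ (Finset.mem_toLeft.1 hb)
    have h₂ := hratio _ hsS _ (Finset.mem_toLeft.1 hnb)
    simp only [hz, Sum.elim_inl, torusRoot_not] at h₁ h₂
    rw [pow_mul, ← mul_one 1]
    nth_rewrite 1 [← h₁]
    rw [← h₂, ← mul_pow]
    congr 1
    have := torusRoot_ne_zero k (j, b)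
    field_simp

end torusRoot

theorem mult_bounded_of_no_lower_dim_eigenvalue (d : ℕ) (hd : 2 ≤ d) :
    ∃ C : ℕ, 0 < C ∧ ∀ N : ℕ, 3 ≤ N → ∀ μ : ℝ, 1 ≤ torusMult N d μ →
      ¬ (∃ r : ℕ, 1 ≤ r ∧ r ≤ d ∧ r ∈ IZeroSet N ∧
        ((r < d ∧ 1 ≤ torusMult N (d - r) μ) ∨ (r = d ∧ μ = 0))) →
      torusMult N d μ ≤ C := by
  classical
  set M := (4 * d).factorial with hM
  have hM0 : 0 < M := Nat.factorial_pos _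
  refine ⟨(2 * M + 2 * d * M) ^ d, by positivity, fun N hN μ hμ hno => ?_⟩
  have hN0 : N ≠ 0 := by omega
  obtain ⟨⟨l, hl⟩⟩ := (Nat.card_pos_iff.1 hμ).1
  set F : Finset ℂ := (Polynomial.nthRoots (2 * M) 1).toFinset ∪
    Finset.univ.biUnion fun t => ((Polynomial.nthRoots M 1).toFinset.image (· * -torusRoot l t)) with hF
  have hcard : ∀ n : ℕ, (Polynomial.nthRoots n (1 : ℂ)).toFinset.card ≤ n := fun n =>
    (Multiset.toFinset_card_le _).trans (Polynomial.card_nthRoots n 1)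
  have hFcard : F.card ≤ 2 * M + 2 * d * M := by
    refine (Finset.card_union_le _ _).trans (Nat.add_le_add (hcard _) ?_)
    refine (Finset.card_biUnion_le_card_mul _ _ M fun t _ =>
      Finset.card_image_le.trans (hcard M)).trans_eq ?_
    simp only [Finset.card_univ, Fintype.card_prod, Fintype.card_fin, Fintype.card_bool]
    ring
  have hmem : ∀ k : {k : Fin d → Fin N // ∑ j, 2 * Real.cos (2 * Real.pi * (k j : ℝ) / N) = μ},
      ∀ j, torusRoot k.1 (j, true) ∈ F := fun k j => by
    rw [hF, Finset.mem_union, Multiset.mem_toFinset, Polynomial.mem_nthRoots (by positivity)]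
    refine (torusRoot_pow_eq_one_or_exists k.1 l hN0 k.2 hl hno (j, true)).imp id ?_
    rintro ⟨t, ht⟩
    refine Finset.mem_biUnion.2 ⟨t, Finset.mem_univ _, Finset.mem_image.2
      ⟨torusRoot k.1 (j, true) / -torusRoot l t, ?_, ?_⟩⟩
    · exact Multiset.mem_toFinset.2 ((Polynomial.mem_nthRoots hM0).2 ht)
    · exact div_mul_cancel₀ _ (neg_ne_zero.2 (torusRoot_ne_zero l t))
  refine (Nat.card_le_card_of_injective (β := Fin d → F) (fun k j => ⟨_, hmem k j⟩) ?_).trans ?_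
  · intro k k' h
    refine Subtype.ext (funext fun j => Fin.ext ?_)
    have hj := congrArg Subtype.val (congrFun h j)
    simp only [torusRoot, if_true] at hj
    exact (Complex.isPrimitiveRoot_exp N hN0).pow_inj (k.1 j).2 (k'.1 j).2 hj
  · rw [Nat.card_fun, Nat.card_eq_fintype_card, Nat.card_eq_fintype_card, Fintype.card_coe,
      Fintype.card_fin]
    exact Nat.pow_le_pow_left hFcard d
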